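/- Let E be a uniformly convex Banach space and D a nonempty closed bounded convex subset of E. If F : D → E is nonexpansive, then the map I − F is demiclosed on D: whenever a sequence (x_n) in D converges weakly to a point x_0 (necessarily x_0 ∈ D) and the sequence x_n − F(x_n) converges in norm to y ∈ E, then x_0 − F(x_0) = y. In particular, if there is a sequence (x_n) in D with ‖x_n − F(x_n)‖ → 0, then F has a fixed point in D. -/

import Mathlib

open Filter
open scoped Topology

lemma uc_scaled {E : Type*} [NormedAddCommGroup E] [NormedSpace ℝ E] [UniformConvexSpace E]
    {ε M : ℝ} (hε : 0 < ε) (hM : 0 < M) :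
    ∃ η : ℝ, 0 < η ∧ ∀ R : ℝ, 0 < R → R ≤ M → ∀ a b : E, ‖a‖ ≤ R → ‖b‖ ≤ R →
      ε ≤ ‖a - b‖ → ‖a + b‖ ≤ (2 - η) * R := by
  obtain ⟨η, hη, h⟩ := exists_forall_closed_ball_dist_add_le_two_sub E (div_pos hε hM)
  refine ⟨η, hη, fun R hR hRM a b ha hb hab => ?_⟩
  have hn : ∀ c : E, ‖R⁻¹ • c‖ = ‖c‖ / R := fun c => by
    rw [norm_smul, norm_inv, Real.norm_of_nonneg hR.le, div_eq_inv_mul]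
  have := @h (R⁻¹ • a) (by rw [hn]; exact (div_le_one hR).2 ha) (R⁻¹ • b)
    (by rw [hn]; exact (div_le_one hR).2 hb)
    (by
      rw [← smul_sub, hn]
      exact div_le_div₀ (norm_nonneg _) hab hR hRM)
  rw [← smul_add, hn] at this
  exact (div_le_iff₀ hR).1 this

/-- approximate fixed points -/
def apx {E : Type*} [NormedAddCommGroup E] (D : Set E) (G : E → E) (ε : ℝ) : Set E :=
  {x | x ∈ D ∧ ‖x - G x‖ ≤ ε}

section
variable {E : Type*} [NormedAddCommGroup E] [NormedSpace ℝ E]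
    {D : Set E} {G : E → E}

lemma apx_closed (hDcl : IsClosed D) (hG : ∀ x ∈ D, ∀ y ∈ D, ‖G x - G y‖ ≤ ‖x - y‖) (ε : ℝ) :
    IsClosed (apx D G ε) := by
  rw [← closure_subset_iff_isClosed]
  intro z hz
  have hzD : z ∈ D := closure_minimal (fun x hx => hx.1) hDcl hz
  refine ⟨hzD, le_of_forall_pos_le_add fun κ hκ => ?_⟩
  obtain ⟨x, hx, hd⟩ := Metric.mem_closure_iff.1 hz (κ / 2) (by positivity)
  rw [dist_eq_norm] at hd
  have h1 := hG x hx.1 z hzD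
  rw [norm_sub_rev x z] at h1
  have h2 := hx.2
  have h3 : z - G z = (z - x) + (x - G x) + (G x - G z) := by abel
  rw [h3]
  have := norm_add₃_le (a := z - x) (b := x - G x) (c := G x - G z)
  linarith

lemma apx_seg [UniformConvexSpace E] (hDb : Bornology.IsBounded D) (hDconv : Convex ℝ D)
    (hG : ∀ x ∈ D, ∀ y ∈ D, ‖G x - G y‖ ≤ ‖x - y‖) {ε : ℝ} (hε : 0 < ε) :
    ∃ δ : ℝ, 0 < δ ∧ ∀ u ∈ apx D G δ, ∀ v ∈ apx D G δ, segment ℝ u v ⊆ apx D G ε := by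
  obtain ⟨M, hM⟩ := Metric.isBounded_iff.1 hDb
  obtain ⟨η, hη, h⟩ := uc_scaled (E := E) hε (M := max M 0 + 1) (by positivity)
  refine ⟨min 1 (min (ε / 4) (η * ε / 24)), by positivity, ?_⟩
  set δ := min 1 (min (ε / 4) (η * ε / 24)) with hδ
  have hδ0 : 0 < δ := by positivity
  have hδ1 : δ ≤ 1 := min_le_left _ _
  have hδ2 : δ ≤ ε / 4 := (min_le_right _ _).trans (min_le_left _ _)
  have hδ3 : δ ≤ η * ε / 24 := (min_le_right _ _).trans (min_le_right _ _)
  rintro u ⟨huD, hu⟩ v ⟨hvD, hv⟩ w hw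
  have hwD : w ∈ D := hDconv.segment_subset huD hvD hw
  refine ⟨hwD, ?_⟩
  by_contra! hlt
  have hd : ‖w - u‖ + ‖w - v‖ = ‖u - v‖ := by
    have := dist_add_dist_of_mem_segment hw
    rw [dist_eq_norm, dist_eq_norm, dist_eq_norm] at this
    rw [norm_sub_rev w u]; exact this
  have huv : ‖u - v‖ ≤ M := by rw [← dist_eq_norm]; exact hM huD hvD
  have h1 : ‖G w - u‖ ≤ ‖w - u‖ + δ := by
    have e : G w - u = (G w - G u) - (u - G u) := by abel
    rw [e]
    have := norm_sub_le (G w - G u) (u - G u)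
    have := hG w hwD u huD
    linarith
  have h2 : ‖G w - v‖ ≤ ‖w - v‖ + δ := by
    have e : G w - v = (G w - G v) - (v - G v) := by abel
    rw [e]
    have := norm_sub_le (G w - G v) (v - G v)
    have := hG w hwD v hvD
    linarith
  have h3 : ‖w - G w‖ ≤ ‖w - u‖ + ‖G w - u‖ := by
    have e : w - G w = (w - u) - (G w - u) := by abel
    rw [e]; exact norm_sub_le _ _
  have hbig : ε / 4 < ‖w - u‖ := by linarith
  have hn := norm_nonneg (w - v)
  have h4 := h (‖w - u‖ + δ) (by positivity)
    (by have := le_max_left M 0; linarith) (w - u) (G w - u) (by linarith) h1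
    (by rw [sub_sub_sub_cancel_right]; exact hlt.le)
  have h5 : 2 * ‖u - v‖ ≤ ‖(w - u) + (G w - u)‖ + (‖w - v‖ + ‖G w - v‖) := by
    have e : (2 : ℝ) • (u - v) = ((w - v) + (G w - v)) - ((w - u) + (G w - u)) := by
      rw [two_smul]; abel
    have : ‖(2 : ℝ) • (u - v)‖ = 2 * ‖u - v‖ := by rw [norm_smul]; norm_num
    rw [← this, e]
    have := norm_sub_le ((w - v) + (G w - v)) ((w - u) + (G w - u))
    have := norm_add_le (w - v) (G w - v)
    linarith
  nlinarith [mul_pos hη hδ0, mul_lt_mul_of_pos_left hbig hη]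

lemma apx_hull (step : ∀ ε : ℝ, 0 < ε → ∃ δ : ℝ, 0 < δ ∧
      ∀ u ∈ apx D G δ, ∀ v ∈ apx D G δ, segment ℝ u v ⊆ apx D G ε)
    {x : ℕ → E} (hx : ∀ δ : ℝ, 0 < δ → ∀ᶠ n in atTop, x n ∈ apx D G δ)
    {ε : ℝ} (hε : 0 < ε) :
    ∃ k : ℕ → ℕ, (∀ n, n ≤ k n) ∧ convexHull ℝ (Set.range fun n => x (k n)) ⊆ apx D G ε := by
  choose! g hg0 hg using step
  let e : ℕ → ℝ := fun n => g^[n] ε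
  have he : ∀ n, e (n + 1) = g (e n) := fun n => Function.iterate_succ_apply' g n ε
  have he0 : ∀ n, 0 < e n := by
    intro n
    induction n with
    | zero => exact hε
    | succ n ih => rw [he]; exact hg0 _ ih
  have hk : ∀ n, ∃ k, n ≤ k ∧ x k ∈ apx D G (e (n + 1)) := fun n =>
    ((eventually_ge_atTop n).and (hx _ (he0 (n + 1)))).exists
  choose k hkn hk using hk
  refine ⟨k, hkn, ?_⟩
  have key : ∀ m N, convexHull ℝ ((fun n => x (k n)) '' Set.Ico N (N + m)) ⊆ apx D G (e N) := by
    intro m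
    induction m with
    | zero => intro N; simp
    | succ m ih =>
      intro N
      have hset : Set.Ico N (N + (m + 1)) = insert N (Set.Ico (N + 1) (N + 1 + m)) := by
        ext i; simp only [Set.mem_Ico, Set.mem_insert_iff]; omega
      have ha : x (k N) ∈ apx D G (g (e N)) := by rw [← he]; exact hk N
      rw [hset, Set.image_insert_eq]
      rcases Set.eq_empty_or_nonempty ((fun n => x (k n)) '' Set.Ico (N + 1) (N + 1 + m)) with h0 | h0
      · rw [h0]
        intro w hw
        have : w = x (k N) := by simpa using hw
        rw [this]
        exact hg _ (he0 N) _ ha _ ha (left_mem_segment ℝ _ _)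
      · rw [convexHull_insert h0]
        intro w hw
        obtain ⟨a, haa, b, hb, hw⟩ := mem_convexJoin.1 hw
        rw [Set.mem_singleton_iff] at haa
        subst haa
        have hb' := ih (N + 1) hb
        rw [he] at hb'
        exact hg _ (he0 N) _ ha _ hb' hw
  have hmono : Monotone fun m => convexHull ℝ ((fun n => x (k n)) '' Set.Ico 0 (0 + m)) := by
    intro a b hab
    exact convexHull_mono (Set.image_mono (Set.Ico_subset_Ico_right (by omega)))
  have hconv : Convex ℝ (⋃ m, convexHull ℝ ((fun n => x (k n)) '' Set.Ico 0 (0 + m))) :=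
    hmono.directed_le.convex_iUnion fun {m} => convex_convexHull ℝ _
  refine (convexHull_min ?_ hconv).trans (Set.iUnion_subset fun m => key m 0)
  rintro _ ⟨n, rfl⟩
  exact Set.mem_iUnion.2 ⟨n + 1, subset_convexHull ℝ _ ⟨n, by simp, rfl⟩⟩

lemma weak_mem {x : ℕ → E} {x₀ : E}
    (hw : ∀ f : E →L[ℝ] ℝ, Tendsto (fun n => f (x n)) atTop (𝓝 (f x₀)))
    {C : Set E} (hC : IsClosed C) (hconv : Convex ℝ C) (hx : ∀ n, x n ∈ C) : x₀ ∈ C := by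
  by_contra h
  obtain ⟨f, u, h1, h2⟩ := geometric_hahn_banach_closed_point hconv hC h
  have := le_of_tendsto (hw f) (Eventually.of_forall fun n => (h1 _ (hx n)).le)
  linarith

lemma apx_zero {z : E} (h : ∀ ε : ℝ, 0 < ε → z ∈ apx D G ε) : z ∈ D ∧ z = G z := by
  refine ⟨(h 1 one_pos).1, sub_eq_zero.1 (norm_le_zero_iff.1 ?_)⟩
  exact le_of_forall_pos_le_add fun κ hκ => by rw [zero_add]; exact (h κ hκ).2

lemma demi [UniformConvexSpace E] (hDcl : IsClosed D) (hDb : Bornology.IsBounded D)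
    (hDconv : Convex ℝ D) (hG : ∀ x ∈ D, ∀ y ∈ D, ‖G x - G y‖ ≤ ‖x - y‖)
    {x : ℕ → E} {x₀ : E} (hx : ∀ δ : ℝ, 0 < δ → ∀ᶠ n in atTop, x n ∈ apx D G δ)
    (hw : ∀ f : E →L[ℝ] ℝ, Tendsto (fun n => f (x n)) atTop (𝓝 (f x₀))) :
    x₀ ∈ D ∧ x₀ = G x₀ := by
  refine apx_zero fun ε hε => ?_
  obtain ⟨k, hk, hull⟩ := apx_hull (fun ε hε => apx_seg hDb hDconv hG hε) hx hε
  have hkt : Tendsto k atTop atTop := tendsto_atTop_mono hk tendsto_id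
  have := weak_mem (x := fun n => x (k n)) (fun f => (hw f).comp hkt)
    (isClosed_closure (s := convexHull ℝ (Set.range fun n => x (k n))))
    (convex_convexHull ℝ _).closure
    (fun n => subset_closure (subset_convexHull ℝ _ ⟨n, rfl⟩))
  exact closure_minimal hull (apx_closed hDcl hG ε) this

lemma exists_fix [CompleteSpace E] [UniformConvexSpace E] (hDcl : IsClosed D)
    (hDb : Bornology.IsBounded D)
    (hDconv : Convex ℝ D) (hG : ∀ x ∈ D, ∀ y ∈ D, ‖G x - G y‖ ≤ ‖x - y‖)
    (hne : ∀ δ : ℝ, 0 < δ → (apx D G δ).Nonempty) :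
    ∃ z ∈ D, G z = z := by
  have mono : ∀ {a b : ℝ}, a ≤ b → apx D G a ⊆ apx D G b := fun hab x hx => ⟨hx.1, hx.2.trans hab⟩
  let A : Set ℝ := {r | ∀ ε : ℝ, 0 < ε → ∃ x ∈ apx D G ε, ‖x‖ ≤ r}
  obtain ⟨B, hB⟩ := isBounded_iff_forall_norm_le.1 hDb
  have hAne : A.Nonempty := ⟨B, fun ε hε => by
    obtain ⟨x, hx⟩ := hne ε hε
    exact ⟨x, hx, hB x hx.1⟩⟩
  have hA0 : ∀ r ∈ A, 0 ≤ r := fun r hr => by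
    obtain ⟨x, -, hx⟩ := hr 1 one_pos
    exact (norm_nonneg x).trans hx
  have hAb : BddBelow A := ⟨0, hA0⟩
  set d := sInf A with hd
  have hd0 : 0 ≤ d := le_csInf hAne hA0
  have hup : ∀ κ : ℝ, 0 < κ → ∃ x ∈ apx D G κ, ‖x‖ ≤ d + κ := by
    intro κ hκ
    obtain ⟨r, hr, hlt⟩ := exists_lt_of_csInf_lt hAne (show sInf A < d + κ by linarith)
    obtain ⟨x, hx, hxr⟩ := hr κ hκ
    exact ⟨x, hx, hxr.trans hlt.le⟩
  have hlow : ∀ κ : ℝ, 0 < κ → ∃ ε : ℝ, 0 < ε ∧ ∀ x ∈ apx D G ε, d - κ < ‖x‖ := by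
    intro κ hκ
    by_contra! hcon
    have : d ≤ d - κ := csInf_le hAb hcon
    linarith
  have hC : ∀ ε : ℝ, 0 < ε → ∃ δ : ℝ, 0 < δ ∧ ∀ x ∈ apx D G δ, ∀ y ∈ apx D G δ,
      ‖x‖ ≤ d + δ → ‖y‖ ≤ d + δ → ‖x - y‖ < ε := by
    intro ε hε
    rcases hd0.eq_or_lt with h0 | hpos
    · refine ⟨ε / 3, by positivity, fun x _ y _ hx hy => ?_⟩
      have := norm_sub_le x y
      linarith
    · obtain ⟨η, hη, h⟩ := uc_scaled (E := E) hε (M := d + 1) (by positivity)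
      obtain ⟨ε₁, hε₁, h1⟩ := hlow (η * d / 8) (by positivity)
      obtain ⟨ε₂, hε₂, h2⟩ := apx_seg hDb hDconv hG hε₁
      refine ⟨min 1 (min ε₂ (η * d / 8)), by positivity, ?_⟩
      set δ := min 1 (min ε₂ (η * d / 8)) with hδ
      have hδ0 : 0 < δ := by positivity
      have hδ1 : δ ≤ 1 := min_le_left _ _
      have hδ2 : δ ≤ ε₂ := (min_le_right _ _).trans (min_le_left _ _)
      have hδ3 : δ ≤ η * d / 8 := (min_le_right _ _).trans (min_le_right _ _)
      intro x hx y hy hxn hyn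
      by_contra! hcon
      have h3 := h (d + δ) (by positivity) (by linarith) x y hxn hyn hcon
      have h4 := h1 _ (h2 x (mono hδ2 hx) y (mono hδ2 hy) (midpoint_mem_segment (𝕜 := ℝ) x y))
      have h5 : ‖midpoint ℝ x y‖ = ‖x + y‖ / 2 := by
        rw [midpoint_eq_smul_add, norm_smul]; norm_num; ring
      rw [h5] at h4
      nlinarith [mul_pos hη hδ0, mul_pos hη hpos]
  have hp : ∀ n : ℕ, (0 : ℝ) < 1 / ((n : ℝ) + 1) := fun n => by positivity
  choose x hx hxn using fun n : ℕ => hup (1 / ((n : ℝ) + 1)) (hp n)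
  have hle : ∀ δ : ℝ, 0 < δ → ∃ N : ℕ, ∀ n ≥ N, 1 / ((n : ℝ) + 1) ≤ δ := by
    intro δ hδ
    obtain ⟨N, hN⟩ := exists_nat_one_div_lt hδ
    refine ⟨N, fun n hn => le_trans (one_div_le_one_div_of_le (by positivity) ?_) hN.le⟩
    have : (N : ℝ) ≤ n := by exact_mod_cast hn
    linarith
  have hcau : CauchySeq x := by
    rw [Metric.cauchySeq_iff]
    intro ε hε
    obtain ⟨δ, hδ, h⟩ := hC ε hε
    obtain ⟨N, hN⟩ := hle δ hδ
    refine ⟨N, fun m hm n hn => ?_⟩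
    rw [dist_eq_norm]
    exact h _ (mono (hN m hm) (hx m)) _ (mono (hN n hn) (hx n))
      ((hxn m).trans (by linarith [hN m hm])) ((hxn n).trans (by linarith [hN n hn]))
  obtain ⟨z, hz⟩ := cauchySeq_tendsto_of_complete hcau
  have := apx_zero (D := D) (G := G) (z := z) fun ε hε => by
    obtain ⟨N, hN⟩ := hle ε hε
    exact (apx_closed hDcl hG ε).mem_of_tendsto hz
      (eventually_atTop.2 ⟨N, fun n hn => mono (hN n hn) (hx n)⟩)
  exact ⟨z, this.1, this.2.symm⟩
end




theorem stmt19 {E : Type*} [NormedAddCommGroup E] [NormedSpace ℝ E] [CompleteSpace E]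
    [UniformConvexSpace E]
    (D : Set E) (hDne : D.Nonempty) (hDcl : IsClosed D)
    (hDb : Bornology.IsBounded D) (hDconv : Convex ℝ D)
    (F : E → E) (hF : ∀ x ∈ D, ∀ y ∈ D, ‖F x - F y‖ ≤ ‖x - y‖) :
    -- `I - F` is demiclosed on `D`
    (∀ x : ℕ → E, (∀ n, x n ∈ D) → ∀ x₀ y : E,
      (∀ f : E →L[ℝ] ℝ, Tendsto (fun n => f (x n)) atTop (𝓝 (f x₀))) →
      Tendsto (fun n => x n - F (x n)) atTop (𝓝 y) →
      x₀ ∈ D ∧ x₀ - F x₀ = y) ∧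
    -- in particular: an almost-fixed-point sequence yields a fixed point
    ((∃ x : ℕ → E, (∀ n, x n ∈ D) ∧
        Tendsto (fun n => ‖x n - F (x n)‖) atTop (𝓝 0)) →
      ∃ z ∈ D, F z = z) := by

  constructor
  · intro x hx x₀ y hw hy
    have := demi (G := fun x => F x + y) hDcl hDb hDconv
      (fun a ha b hb => by simpa using hF a ha b hb) (x := x) (x₀ := x₀) (fun δ hδ => by
        filter_upwards [Metric.tendsto_nhds.1 hy δ hδ] with n hn
        refine ⟨hx n, ?_⟩
        rw [dist_eq_norm, sub_sub] at hn
        exact hn.le) hw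
    refine ⟨this.1, ?_⟩
    rw [sub_eq_iff_eq_add, add_comm]
    exact this.2
  · rintro ⟨x, hx, hlim⟩
    refine exists_fix hDcl hDb hDconv hF fun δ hδ => ?_
    obtain ⟨n, hn⟩ := (hlim.eventually (gt_mem_nhds hδ)).exists
    exact ⟨x n, hx n, hn.le⟩
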